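/- Let [x_k], k ∈ [0,N], be a zero-mean nonsingular Gaussian sequence with covariance C, let A = C⁻¹, and let k_2 ∈ [1,N−1]. Partition A into blocks A11 = A_[1:k_2+1,1:k_2+1] (the first k_2+1 block rows and columns), A22 = A_[k_2+2:N+1,k_2+2:N+1], and A12 = A_[1:k_2+1,k_2+2:N+1]. Then [x_k] is [0,k_2]-CM_c for c ∈ {0,k_2} if and only if the Schur complement Δ_{A22} = A11 − A12 A22⁻¹ A12' has the CM_c form as a matrix of (k_2+1)×(k_2+1) blocks of size d×d. -/

import Mathlib

open MeasureTheory ProbabilityTheory Matrix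
open scoped NNReal

namespace CMSeqPaper

variable {Ω : Type*} [MeasurableSpace Ω]

/-- Square `d × d` real matrices. -/
abbrev Mat (d : ℕ) := Matrix (Fin d) (Fin d) ℝ

/-- `X` is a zero-mean jointly Gaussian random vector with covariance matrix `C`
(Cramér–Wold characterization: every linear functional of `X` is a centered real
Gaussian with the induced variance). -/
def IsZeroMeanGaussian {ι : Type*} [Fintype ι] (μ : Measure Ω)
    (X : Ω → ι → ℝ) (C : Matrix ι ι ℝ) : Prop :=
  ∀ l : ι → ℝ,
    μ.map (fun ω => ∑ i, l i * X ω i) = gaussianReal 0 (l ⬝ᵥ C.mulVec l).toNNReal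

/-- The stacked vector over times `0, …, N` of a `d`-dimensional sequence. -/
def stack (N d : ℕ) (x : ℕ → Ω → Fin d → ℝ) : Ω → Fin (N + 1) × Fin d → ℝ :=
  fun ω p => x (p.1 : ℕ) ω p.2

/-- `[x_k]`, `k ∈ [0,N]`, is a zero-mean nonsingular Gaussian sequence whose stacked
vector has (positive definite) covariance matrix `C`. -/
def ZMNG (N d : ℕ) (μ : Measure Ω) (x : ℕ → Ω → Fin d → ℝ)
    (C : Matrix (Fin (N + 1) × Fin d) (Fin (N + 1) × Fin d) ℝ) : Prop :=
  (∀ k, k ≤ N → Measurable (x k)) ∧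
    IsZeroMeanGaussian μ (stack N d x) C ∧ C.PosDef

/-- The σ-algebra generated by the states at the times in `S`. -/
def sigmaOf {d : ℕ} (x : ℕ → Ω → Fin d → ℝ) (S : Set ℕ) : MeasurableSpace Ω :=
  ⨆ i ∈ S, MeasurableSpace.comap (x i) inferInstance

/-- The conditional distribution of `x k` given the states at the times in `S`
coincides (a.e.) with the conditional distribution of `x k` given the states at the
times in `T`. -/
def CondEq {d : ℕ} (μ : Measure Ω) (x : ℕ → Ω → Fin d → ℝ) (k : ℕ)
    (S T : Set ℕ) : Prop :=
  ∀ A : Set (Fin d → ℝ), MeasurableSet A →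
    μ[A.indicator (fun _ => (1 : ℝ)) ∘ x k | sigmaOf x S]
      =ᵐ[μ] μ[A.indicator (fun _ => (1 : ℝ)) ∘ x k | sigmaOf x T]

/-- `[x_k]` is `[k₁,k₂]`-CM_c: for all `k₁ ≤ j < k ≤ k₂`, the conditional
distribution of `x k` given `(x_{k₁}, …, x_j, x_c)` equals the one given `(x_j, x_c)`. -/
def IsCM {d : ℕ} (μ : Measure Ω) (x : ℕ → Ω → Fin d → ℝ) (k₁ k₂ c : ℕ) : Prop :=
  ∀ j k, k₁ ≤ j → j < k → k ≤ k₂ →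
    CondEq μ x k (Set.Icc k₁ j ∪ {c}) ({j} ∪ {c})

/-- `[x_k]` is Markov on the index interval `[a,b]`. -/
def IsMarkovOn {d : ℕ} (μ : Measure Ω) (x : ℕ → Ω → Fin d → ℝ) (a b : ℕ) : Prop :=
  ∀ j k, a ≤ j → j < k → k ≤ b → CondEq μ x k (Set.Icc a j) {j}

/-- `[x_k]` is reciprocal on `[0,N]`. -/
def IsReciprocal {d : ℕ} (μ : Measure Ω) (x : ℕ → Ω → Fin d → ℝ) (N : ℕ) : Prop :=
  ∀ j k l, j < k → k < l → l ≤ N →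
    CondEq μ x k (Set.Icc 0 j ∪ Set.Icc l N) ({j} ∪ {l})

/-- Block `(i,j)` of the block matrix `A` is zero. -/
def BlockZero {n d : ℕ} (A : Matrix (Fin n × Fin d) (Fin n × Fin d) ℝ)
    (i j : Fin n) : Prop :=
  ∀ a b, A (i, a) (j, b) = 0

/-- `|i - j| ≥ 2` for block indices. -/
def Far {n : ℕ} (i j : Fin n) : Prop :=
  (i : ℕ) + 2 ≤ (j : ℕ) ∨ (j : ℕ) + 2 ≤ (i : ℕ)

/-- Block tri-diagonal: every block `(i,j)` with `|i-j| ≥ 2` is zero. -/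
def BlockTriDiag {n d : ℕ} (A : Matrix (Fin n × Fin d) (Fin n × Fin d) ℝ) : Prop :=
  ∀ i j, Far i j → BlockZero A i j

/-- The CM_L form: every block `(i,j)` with `|i-j| ≥ 2` is zero except possibly
blocks in the last block row and last block column. -/
def HasCMLForm {n d : ℕ} (A : Matrix (Fin n × Fin d) (Fin n × Fin d) ℝ) : Prop :=
  ∀ i j, Far i j → (i : ℕ) ≠ n - 1 → (j : ℕ) ≠ n - 1 → BlockZero A i j

/-- The CM_F form: every block `(i,j)` with `|i-j| ≥ 2` is zero except possibly
blocks in the first block row and first block column. -/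
def HasCMFForm {n d : ℕ} (A : Matrix (Fin n × Fin d) (Fin n × Fin d) ℝ) : Prop :=
  ∀ i j, Far i j → (i : ℕ) ≠ 0 → (j : ℕ) ≠ 0 → BlockZero A i j

/-- Cyclic block tri-diagonal: every block `(i,j)` with `|i-j| ≥ 2` is zero except
possibly the corner blocks `(0, n-1)` and `(n-1, 0)`. -/
def CyclicBlockTriDiag {n d : ℕ} (A : Matrix (Fin n × Fin d) (Fin n × Fin d) ℝ) : Prop :=
  ∀ i j, Far i j → ¬((i : ℕ) = 0 ∧ (j : ℕ) = n - 1) →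
    ¬((i : ℕ) = n - 1 ∧ (j : ℕ) = 0) → BlockZero A i j

/-- The stacked block-diagonal matrix with diagonal blocks `G 0, …, G N`. -/
def blockDiag (N d : ℕ) (G : ℕ → Mat d) :
    Matrix (Fin (N + 1) × Fin d) (Fin (N + 1) × Fin d) ℝ :=
  fun p q => if (p.1 : ℕ) = (q.1 : ℕ) then G (p.1 : ℕ) p.2 q.2 else 0

/-- `[x_k]` obeys the CM_L model with parameters `Gm k = G_{k,k-1}` and
`GN k = G_{k,N}` for `k ∈ [1,N-1]`, boundary parameter `GN 0 = G_{0,N}`, and noise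
covariances `Gcov k = G_k = Cov(e_k)`: the `e_k` are zero-mean jointly Gaussian,
mutually uncorrelated, with positive definite covariances, with
`x_k = G_{k,k-1} x_{k-1} + G_{k,N} x_N + e_k` for `k ∈ [1,N-1]`, and boundary
condition `x_N = e_N`, `x_0 = G_{0,N} x_N + e_0`. -/
def CMLModel (N d : ℕ) (μ : Measure Ω) (x : ℕ → Ω → Fin d → ℝ)
    (Gm GN Gcov : ℕ → Mat d) : Prop :=
  ∃ e : ℕ → Ω → Fin d → ℝ,
    ZMNG N d μ e (blockDiag N d Gcov) ∧
    (∀ k, k ≤ N → (Gcov k).PosDef) ∧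
    (∀ᵐ ω ∂μ,
      (∀ k, 1 ≤ k → k ≤ N - 1 →
        x k ω = (Gm k).mulVec (x (k - 1) ω) + (GN k).mulVec (x N ω) + e k ω) ∧
      x N ω = e N ω ∧ x 0 ω = (GN 0).mulVec (x N ω) + e 0 ω)

/-- `[y_k]` obeys the Markov model with parameters `Mm k = M_{k,k-1}` for
`k ∈ [1,N]` and noise covariances `Mcov k = M_k = Cov(e_k)`: the `e_k` are
zero-mean jointly Gaussian, mutually uncorrelated, with positive definite
covariances, `y_0 = e_0` and `y_k = M_{k,k-1} y_{k-1} + e_k` for `k ∈ [1,N]`. -/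
def MarkovModel (N d : ℕ) (μ : Measure Ω) (y : ℕ → Ω → Fin d → ℝ)
    (Mm Mcov : ℕ → Mat d) : Prop :=
  ∃ e : ℕ → Ω → Fin d → ℝ,
    ZMNG N d μ e (blockDiag N d Mcov) ∧
    (∀ k, k ≤ N → (Mcov k).PosDef) ∧
    (∀ᵐ ω ∂μ, y 0 ω = e 0 ω ∧
      ∀ k, 1 ≤ k → k ≤ N → y k ω = (Mm k).mulVec (y (k - 1) ω) + e k ω)

/-- Representation of `[x_k]` as a zero-mean nonsingular Gaussian Markov sequence
plus `Γ_k x_c`, where `c ∈ {0,N}`: `y` (which coincides with `x` at time `c`) is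
jointly zero-mean nonsingular Gaussian, the states of `y` at times `≠ c` are
uncorrelated with `y c = x c`, `y` is Markov on `[0,N] \ {c}`, and
`x_k = y_k + Γ_k x_c` for `k ∈ [0,N] \ {c}`. -/
def MarkovPlusVector (N d c : ℕ) (μ : Measure Ω) (x y : ℕ → Ω → Fin d → ℝ)
    (Γ : ℕ → Mat d) : Prop :=
  ∃ C' : Matrix (Fin (N + 1) × Fin d) (Fin (N + 1) × Fin d) ℝ,
    (∀ᵐ ω ∂μ, y c ω = x c ω) ∧
    ZMNG N d μ y C' ∧
    (∀ i j : Fin (N + 1),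
      (((i : ℕ) = c ∧ (j : ℕ) ≠ c) ∨ ((i : ℕ) ≠ c ∧ (j : ℕ) = c)) →
      ∀ a b, C' (i, a) (j, b) = 0) ∧
    IsMarkovOn μ y (if c = 0 then 1 else 0) (if c = 0 then N else N - 1) ∧
    (∀ᵐ ω ∂μ, ∀ k, k ≤ N → k ≠ c → x k ω = y k ω + (Γ k).mulVec (x c ω))

/-- `M_{N|k} = M_{N,N-1} ⋯ M_{k+1,k}` (with `M_{N|N} = I`), where `Mm k = M_{k,k-1}`. -/
def MNk (d : ℕ) (Mm : ℕ → Mat d) (N k : ℕ) : Mat d :=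
  (List.range (N - k)).foldl (fun A i => A * Mm (N - i)) 1

/-- `C_{N|k} = ∑_{n=k}^{N-1} M_{N|n+1} M_{n+1} M_{N|n+1}'`. -/
def CNk (d : ℕ) (Mm Mcov : ℕ → Mat d) (N k : ℕ) : Mat d :=
  ∑ n ∈ Finset.Icc k (N - 1), MNk d Mm N (n + 1) * Mcov (n + 1) * (MNk d Mm N (n + 1))ᵀ

/-- The `(N+1)d × (N+1)d` matrix `[[B₁, 0], [0, 0]]` (`B₁` occupies the first `N`
block rows and columns). -/
def embedL (N d : ℕ) (B₁ : Matrix (Fin N × Fin d) (Fin N × Fin d) ℝ) :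
    Matrix (Fin (N + 1) × Fin d) (Fin (N + 1) × Fin d) ℝ :=
  fun p q =>
    if h : (p.1 : ℕ) < N ∧ (q.1 : ℕ) < N then
      B₁ (⟨(p.1 : ℕ), h.1⟩, p.2) (⟨(q.1 : ℕ), h.2⟩, q.2)
    else 0

/-- The `(N+1)d × d` matrix `Γ = [S; I]`. -/
def gammaL (N d : ℕ) (S : Matrix (Fin N × Fin d) (Fin d) ℝ) :
    Matrix (Fin (N + 1) × Fin d) (Fin d) ℝ :=
  fun p a =>
    if h : (p.1 : ℕ) < N then S (⟨(p.1 : ℕ), h⟩, p.2) a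
    else (1 : Mat d) p.2 a

/-- The `(N+1)d × (N+1)d` matrix `[[0, 0], [0, B₂]]` (`B₂` occupies the last `N`
block rows and columns). -/
def embedF (N d : ℕ) (B₂ : Matrix (Fin N × Fin d) (Fin N × Fin d) ℝ) :
    Matrix (Fin (N + 1) × Fin d) (Fin (N + 1) × Fin d) ℝ :=
  fun p q =>
    if h : 0 < (p.1 : ℕ) ∧ 0 < (q.1 : ℕ) then
      B₂ (⟨(p.1 : ℕ) - 1, by have := p.1.isLt; omega⟩, p.2)
        (⟨(q.1 : ℕ) - 1, by have := q.1.isLt; omega⟩, q.2)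
    else 0

/-- The `(N+1)d × d` matrix `Γ = [I; S]`. -/
def gammaF (N d : ℕ) (S : Matrix (Fin N × Fin d) (Fin d) ℝ) :
    Matrix (Fin (N + 1) × Fin d) (Fin d) ℝ :=
  fun p a =>
    if h : 0 < (p.1 : ℕ) then
      S (⟨(p.1 : ℕ) - 1, by have := p.1.isLt; omega⟩, p.2) a
    else (1 : Mat d) p.2 a

theorem posdef_zero {ι : Type*} [Fintype ι] {C : Matrix ι ι ℝ} (hC : C.PosDef) {v : ι → ℝ}
    (h : v ⬝ᵥ C *ᵥ v = 0) : v = 0 := by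
  by_contra hv
  have := hC.dotProduct_mulVec_pos hv
  simp [h] at this

theorem posdef_submatrix {ι κ : Type*} [Fintype ι] [Fintype κ] {C : Matrix ι ι ℝ}
    (hC : C.PosDef) (f : κ → ι) (hf : Function.Injective f) : (C.submatrix f f).PosDef := by
  classical
  refine PosDef.of_dotProduct_mulVec_pos (hC.1.submatrix f) fun v hv => ?_
  let w : ι → ℝ := fun i => ∑ k, if f k = i then v k else 0
  have hw : ∀ g : ι → ℝ, ∑ i, w i * g i = ∑ k, v k * g (f k) := by
    intro g
    simp only [w, Finset.sum_mul]
    rw [Finset.sum_comm]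
    refine Finset.sum_congr rfl fun k _ => ?_
    rw [Finset.sum_eq_single (f k)] <;> simp +contextual [eq_comm]
  have hwf : ∀ k, w (f k) = v k := by
    intro k
    simp only [w]
    rw [Finset.sum_eq_single k]
    · simp
    · intro b _ hb
      simp [hf.eq_iff, hb]
    · simp
  have hw0 : w ≠ 0 := by
    intro h
    apply hv
    ext k
    rw [← hwf k, h]; rfl
  have := hC.dotProduct_mulVec_pos hw0
  have e : star w ⬝ᵥ C *ᵥ w = star v ⬝ᵥ (C.submatrix f f) *ᵥ v := by
    simp only [dotProduct, mulVec, star_trivial, submatrix_apply]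
    rw [hw]
    refine Finset.sum_congr rfl fun k _ => ?_
    congr 1
    have := hw (fun j => C (f k) j)
    simpa [mul_comm] using this
  rwa [e] at this

theorem solve {ι : Type*} [Fintype ι] {C : Matrix ι ι ℝ} (hC : C.PosDef) (M : Set ι)
    (u : ι → ℝ) :
    ∃ w : ι → ℝ, (∀ p, p ∉ M → w p = 0) ∧ ∀ q ∈ M, (C *ᵥ (u - w)) q = 0 := by
  classical
  have hS := posdef_submatrix hC (Subtype.val : M → ι) Subtype.val_injective
  set S := C.submatrix (Subtype.val : M → ι) (Subtype.val : M → ι) with hSdef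
  let w' : M → ℝ := S⁻¹ *ᵥ (fun q => (C *ᵥ u) q.1)
  have hw' : S *ᵥ w' = fun q => (C *ᵥ u) q.1 := by
    simp only [w', mulVec_mulVec]
    rw [Matrix.mul_nonsing_inv _ ((Matrix.isUnit_iff_isUnit_det _).1 hS.isUnit), one_mulVec]
  refine ⟨fun p => if h : p ∈ M then w' ⟨p, h⟩ else 0, fun p hp => by simp [hp], fun q hq => ?_⟩
  have h1 := congrFun hw' ⟨q, hq⟩
  rw [mulVec_sub, Pi.sub_apply, sub_eq_zero]
  simp only at h1
  rw [← h1]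
  simp only [mulVec, dotProduct, hSdef, submatrix_apply]
  have := Finset.sum_subset (Finset.subset_univ (Finset.univ.filter (· ∈ M)))
    (f := fun p => C q p * (if h : p ∈ M then w' ⟨p, h⟩ else 0)) (by
      intro p _ hp
      simp at hp
      simp [hp])
  rw [← this, Finset.sum_subtype (Finset.univ.filter (· ∈ M)) (p := (· ∈ M)) (by simp)]
  refine Finset.sum_congr rfl fun p _ => ?_
  simp

/-- vanishing of the `L`-`R` block of the inverse gives residuals orthogonal to `R` -/
theorem alg_forward {ι : Type*} [Fintype ι] [DecidableEq ι] {C : Matrix ι ι ℝ} (hC : C.PosDef)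
    (L M R : Set ι) (hcov : ∀ p, p ∈ L ∨ p ∈ M ∨ p ∈ R)
    (hMR : ∀ p, p ∈ M → p ∉ R)
    (hP : ∀ l ∈ L, ∀ r ∈ R, C⁻¹ r l = 0) (u : ι → ℝ) (hu : ∀ p, p ∈ R → u p = 0) :
    ∃ w : ι → ℝ, (∀ p, p ∉ M → w p = 0) ∧ ∀ q, q ∈ M ∨ q ∈ R → (C *ᵥ (u - w)) q = 0 := by
  classical
  obtain ⟨w, hw, hz⟩ := solve hC M u
  refine ⟨w, hw, ?_⟩
  set z := C *ᵥ (u - w) with hzdef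
  have hPz : C⁻¹ *ᵥ z = u - w := by
    rw [hzdef, mulVec_mulVec, Matrix.nonsing_inv_mul _ ((Matrix.isUnit_iff_isUnit_det _).1 hC.isUnit),
      one_mulVec]
  let zR : ι → ℝ := fun p => if p ∈ R then z p else 0
  have key : zR ⬝ᵥ C⁻¹ *ᵥ zR = 0 := by
    refine Finset.sum_eq_zero fun r _ => ?_
    by_cases hr : r ∈ R
    · have h1 : (C⁻¹ *ᵥ zR) r = (C⁻¹ *ᵥ z) r := by
        refine Finset.sum_congr rfl fun p _ => ?_
        by_cases hp : p ∈ R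
        · simp [zR, hp]
        · rcases hcov p with h | h | h
          · simp [hP p h r hr]
          · simp [zR, hp, hz p h]
          · exact absurd h hp
      rw [h1, hPz]
      simp [hu r hr, hw r (fun h => hMR r h hr)]
    · simp [zR, hr]
  have h0 := posdef_zero hC.inv key
  rintro q (hq | hq)
  · exact hz q hq
  · have := congrFun h0 q
    simpa [zR, hq] using this

theorem alg_backward {ι : Type*} [Fintype ι] [DecidableEq ι] {C : Matrix ι ι ℝ} (hC : C.PosDef)
    (L M R : Set ι) (hcov : ∀ p, p ∈ L ∨ p ∈ M ∨ p ∈ R)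
    (hLR : ∀ p, p ∈ L → p ∉ R) (hMR : ∀ p, p ∈ M → p ∉ R) (hLM : ∀ p, p ∈ L → p ∉ M)
    (H : ∀ l ∈ L, ∃ w : ι → ℝ, (∀ p, p ∉ M → w p = 0) ∧
      ∀ q, q ∈ M ∨ q ∈ R → (C *ᵥ (Pi.single l 1 - w)) q = 0) :
    ∀ l ∈ L, ∀ r ∈ R, C⁻¹ r l = 0 := by
  classical
  intro l₀ hl₀ r hr
  let p : ι → ℝ := fun l => if l ∈ L then C⁻¹ r l else 0
  have H' : ∀ l, ∃ w : ι → ℝ, l ∈ L → (∀ p, p ∉ M → w p = 0) ∧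
      ∀ q, q ∈ M ∨ q ∈ R → (C *ᵥ (Pi.single l 1 - w)) q = 0 := by
    intro l
    by_cases hl : l ∈ L
    · obtain ⟨w, hw⟩ := H l hl
      exact ⟨w, fun _ => hw⟩
    · exact ⟨0, fun h => absurd h hl⟩
  choose w hw using H'
  let v : ι → ℝ := ∑ l, p l • (Pi.single l 1 - w l)
  have hz : ∀ l ∈ L, p ⬝ᵥ C *ᵥ (Pi.single l 1 - w l) = 0 := by
    intro l hl
    have h1 : (C⁻¹ *ᵥ (C *ᵥ (Pi.single l 1 - w l))) r = 0 := by
      rw [mulVec_mulVec, Matrix.nonsing_inv_mul _ ((Matrix.isUnit_iff_isUnit_det _).1 hC.isUnit),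
        one_mulVec]
      have h2 : r ≠ l := by rintro rfl; exact hLR _ hl hr
      simp [h2, (hw l hl).1 r (fun h => hMR r h hr)]
    rw [← h1]
    refine Finset.sum_congr rfl fun q _ => ?_
    by_cases hq : q ∈ L
    · simp [p, hq]
    · have : q ∈ M ∨ q ∈ R := (hcov q).resolve_left hq
      rw [(hw l hl).2 q this]; simp
  have hp0 : ∀ l, l ∉ L → p l = 0 := fun l hl => by simp [p, hl]
  have hvL : ∀ q ∈ L, v q = p q := by
    intro q hq
    simp only [v, Finset.sum_apply, Pi.smul_apply, Pi.sub_apply, smul_eq_mul]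
    rw [Finset.sum_eq_single q]
    · by_cases hq' : q ∈ L
      · simp [(hw q hq').1 q (hLM q hq)]
      · exact absurd hq hq'
    · intro l _ hl
      by_cases hl' : l ∈ L
      · simp [(hw l hl').1 q (hLM q hq), Ne.symm hl]
      · simp [hp0 l hl']
    · simp
  have hCv : C *ᵥ v = ∑ l, p l • (C *ᵥ (Pi.single l 1 - w l)) := by
    simp only [v, mulVec_sum, mulVec_smul]
  have hCv0 : ∀ q, q ∉ L → (C *ᵥ v) q = 0 := by
    intro q hq
    rw [hCv, Finset.sum_apply]
    refine Finset.sum_eq_zero fun l _ => ?_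
    by_cases hl' : l ∈ L
    · simp [(hw l hl').2 q ((hcov q).resolve_left hq)]
    · simp [hp0 l hl']
  have hv0 : v = 0 := by
    apply posdef_zero hC
    have : v ⬝ᵥ C *ᵥ v = p ⬝ᵥ C *ᵥ v := by
      refine Finset.sum_congr rfl fun q _ => ?_
      by_cases hq : q ∈ L
      · rw [hvL q hq]
      · rw [hCv0 q hq]; simp
    rw [this, hCv, dotProduct_sum]
    refine Finset.sum_eq_zero fun l _ => ?_
    by_cases hl' : l ∈ L
    · rw [dotProduct_smul, hz l hl', smul_zero]
    · simp [hp0 l hl']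
  have := hvL l₀ hl₀
  rw [hv0] at this
  simpa [p, hl₀] using this.symm

theorem mul_split {ι κ₁ κ₂ α β : Type*} [Fintype ι] [Fintype κ₁] [Fintype κ₂] [DecidableEq ι]
    (C : Matrix ι ι ℝ)
    (f : κ₁ → ι) (g : κ₂ → ι) (e : Function.Bijective (Sum.elim f g)) (a : α → ι) (b : β → ι) :
    (C * C⁻¹).submatrix a b =
      C.submatrix a f * C⁻¹.submatrix f b + C.submatrix a g * C⁻¹.submatrix g b := by
  ext i j
  simp only [submatrix_apply, mul_apply, Matrix.add_apply]
  rw [← Equiv.sum_comp (Equiv.ofBijective _ e)]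
  simp [Fintype.sum_sum_type]

theorem schur_inv {ι κ₁ κ₂ : Type*} [Fintype ι] [Fintype κ₁] [Fintype κ₂] [DecidableEq ι]
    [DecidableEq κ₁] [DecidableEq κ₂] {C : Matrix ι ι ℝ} (hC : C.PosDef)
    (f : κ₁ → ι) (g : κ₂ → ι) (e : Function.Bijective (Sum.elim f g)) :
    C⁻¹.submatrix f f - C⁻¹.submatrix f g * (C⁻¹.submatrix g g)⁻¹ * (C⁻¹.submatrix f g)ᵀ
      = (C.submatrix f f)⁻¹ := by
  have hf : Function.Injective f := e.1.comp Sum.inl_injective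
  have hg : Function.Injective g := e.1.comp Sum.inr_injective
  have hA := hC.inv
  have hCA : C * C⁻¹ = 1 :=
    Matrix.mul_nonsing_inv _ ((Matrix.isUnit_iff_isUnit_det _).1 hC.isUnit)
  have h11 := mul_split C f g e f f
  have h12 := mul_split C f g e f g
  rw [hCA] at h11 h12
  have e11 : (1 : Matrix ι ι ℝ).submatrix f f = 1 := submatrix_one f hf
  have e12 : (1 : Matrix ι ι ℝ).submatrix f g = 0 := by
    ext i j
    have : f i ≠ g j := fun h => by
      have := @e.1 (Sum.inl i) (Sum.inr j) (by simpa using h)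
      simp at this
    simp [this]
  rw [e11] at h11
  rw [e12] at h12
  have h22 : C⁻¹.submatrix g g * (C⁻¹.submatrix g g)⁻¹ = 1 :=
    Matrix.mul_nonsing_inv _ ((Matrix.isUnit_iff_isUnit_det _).1 (posdef_submatrix hA g hg).isUnit)
  have ht : (C⁻¹.submatrix f g)ᵀ = C⁻¹.submatrix g f := by
    ext i j
    have := hA.1.apply (g i) (f j)
    simpa using this
  rw [ht]
  symm
  apply Matrix.inv_eq_right_inv
  have h12' : C.submatrix f f * C⁻¹.submatrix f g = - (C.submatrix f g * C⁻¹.submatrix g g) :=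
    eq_neg_of_add_eq_zero_left h12.symm
  rw [Matrix.mul_sub, ← Matrix.mul_assoc, ← Matrix.mul_assoc, h12', Matrix.neg_mul, Matrix.neg_mul,
    Matrix.mul_assoc (C.submatrix f g), h22, Matrix.mul_one, sub_neg_eq_add, ← h11]

theorem condExp_indep_pair {E F : Type*} [MeasurableSpace E] [MeasurableSpace F]
    [StandardBorelSpace F] [Nonempty F]
    {μ : Measure Ω} [IsProbabilityMeasure μ] {X : Ω → E} {Y : Ω → F} (hX : Measurable X)
    (hY : Measurable Y) (h : IndepFun X Y μ) {f : E × F → ℝ} (hf : Measurable f)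
    (hfi : Integrable (fun a => f (X a, Y a)) μ) :
    μ[fun a => f (X a, Y a) | MeasurableSpace.comap X inferInstance]
      =ᵐ[μ] fun a => ∫ y, f (X a, y) ∂(μ.map Y) := by
  have h1 := condExp_prod_ae_eq_integral_condDistrib hX hY.aemeasurable hf.stronglyMeasurable hfi
  have hp : IsProbabilityMeasure (μ.map Y) := Measure.isProbabilityMeasure_map hY.aemeasurable
  have h2 : condDistrib Y X μ =ᵐ[μ.map X] Kernel.const E (μ.map Y) := by
    apply condDistrib_ae_eq_of_measure_eq_compProd X hY.aemeasurable
    rw [Measure.compProd_const]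
    exact (indepFun_iff_map_prod_eq_prod_map_map hX.aemeasurable hY.aemeasurable).1 h
  have h3 := ae_of_ae_map hX.aemeasurable h2
  filter_upwards [h1, h3] with a ha hb
  rw [ha, hb, Kernel.const_apply]

/-- linear functional of a random vector -/
noncomputable def lin {ι : Type*} [Fintype ι] (X : Ω → ι → ℝ) (l : ι → ℝ) : Ω → ℝ :=
  fun ω => ∑ i, l i * X ω i

theorem gaussLaw {ι : Type*} [Fintype ι] {μ : Measure Ω} [IsProbabilityMeasure μ] {X : Ω → ι → ℝ}
    {C : Matrix ι ι ℝ} (hm : Measurable X) (h : IsZeroMeanGaussian μ X C) :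
    HasGaussianLaw X μ := by
  classical
  refine ⟨isGaussian_of_map_eq_gaussianReal fun L => ?_⟩
  refine ⟨0, ((fun i => L (Pi.single i 1)) ⬝ᵥ C.mulVec (fun i => L (Pi.single i 1))).toNNReal, ?_⟩
  rw [← h, Measure.map_map (by fun_prop) hm]
  congr 1
  ext ω
  have : X ω = ∑ i, X ω i • (Pi.single i (1 : ℝ) : ι → ℝ) := by
    ext j
    simp [Finset.sum_apply, Pi.single_apply]
  simp only [Function.comp]
  conv_lhs => rw [this]
  simp [mul_comm]

theorem lin_measurable {ι : Type*} [Fintype ι] {X : Ω → ι → ℝ} (hm : Measurable X) (l : ι → ℝ) :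
    Measurable (lin X l) := by
  unfold lin
  have := fun i => (measurable_pi_apply (X := fun _ : ι => ℝ) i).comp hm
  simp only [Function.comp_def] at this
  fun_prop

theorem lin_memLp {ι : Type*} [Fintype ι] {μ : Measure Ω} [IsProbabilityMeasure μ] {X : Ω → ι → ℝ}
    {C : Matrix ι ι ℝ} (hm : Measurable X) (h : IsZeroMeanGaussian μ X C) (l : ι → ℝ) :
    MemLp (lin X l) 2 μ := by
  have h1 := h l
  have h2 : MemLp id 2 (μ.map (lin X l)) := by
    unfold lin
    rw [h1]
    exact memLp_id_gaussianReal 2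
  exact (memLp_map_measure_iff (by fun_prop) (lin_measurable hm l).aemeasurable).1 h2

theorem lin_mean {ι : Type*} [Fintype ι] {μ : Measure Ω} [IsProbabilityMeasure μ] {X : Ω → ι → ℝ}
    {C : Matrix ι ι ℝ} (hm : Measurable X) (h : IsZeroMeanGaussian μ X C) (l : ι → ℝ) :
    ∫ ω, lin X l ω ∂μ = 0 := by
  have h1 := h l
  have h2 : ∫ y, y ∂(μ.map (lin X l)) = 0 := by
    unfold lin
    rw [h1]
    exact integral_id_gaussianReal
  rwa [integral_map (lin_measurable hm l).aemeasurable (by fun_prop)] at h2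

theorem lin_var {ι : Type*} [Fintype ι] {μ : Measure Ω} [IsProbabilityMeasure μ] {X : Ω → ι → ℝ}
    {C : Matrix ι ι ℝ} (hC : C.PosDef) (hm : Measurable X) (h : IsZeroMeanGaussian μ X C)
    (l : ι → ℝ) :
    Var[lin X l; μ] = l ⬝ᵥ C *ᵥ l := by
  have h1 := h l
  have h2 : Var[id; μ.map (lin X l)] = l ⬝ᵥ C *ᵥ l := by
    unfold lin
    rw [h1, variance_id_gaussianReal]
    have := hC.posSemidef.dotProduct_mulVec_nonneg l
    simp at this
    simp [this]
  rwa [variance_map (by fun_prop) (lin_measurable hm l).aemeasurable] at h2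

theorem lin_add {ι : Type*} [Fintype ι] (X : Ω → ι → ℝ) (l m : ι → ℝ) :
    lin X (l + m) = lin X l + lin X m := by
  ext ω
  simp [lin, add_mul, Finset.sum_add_distrib]

theorem lin_cov {ι : Type*} [Fintype ι] {μ : Measure Ω} [IsProbabilityMeasure μ] {X : Ω → ι → ℝ}
    {C : Matrix ι ι ℝ} (hC : C.PosDef) (hm : Measurable X) (h : IsZeroMeanGaussian μ X C)
    (l m : ι → ℝ) :
    cov[lin X l, lin X m; μ] = l ⬝ᵥ C *ᵥ m := by
  have h1 := variance_add (lin_memLp hm h l) (lin_memLp hm h m)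
  rw [← lin_add, lin_var hC hm h, lin_var hC hm h, lin_var hC hm h] at h1
  have h2 : m ⬝ᵥ C *ᵥ l = l ⬝ᵥ C *ᵥ m := by
    have := hC.1.eq
    rw [conjTranspose_eq_transpose_of_trivial] at this
    rw [dotProduct_mulVec, ← mulVec_transpose, this, dotProduct_comm]
  simp only [mulVec_add, dotProduct_add, add_dotProduct] at h1
  linarith

theorem lin_integral_mul {ι : Type*} [Fintype ι] {μ : Measure Ω} [IsProbabilityMeasure μ]
    {X : Ω → ι → ℝ}
    {C : Matrix ι ι ℝ} (hC : C.PosDef) (hm : Measurable X) (h : IsZeroMeanGaussian μ X C)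
    (l m : ι → ℝ) :
    ∫ ω, (lin X l * lin X m) ω ∂μ = l ⬝ᵥ C *ᵥ m := by
  rw [← lin_cov hC hm h, covariance_eq_sub (lin_memLp hm h l) (lin_memLp hm h m), lin_mean hm h,
    lin_mean hm h]
  simp

theorem lin_indep {ι κ₁ κ₂ : Type*} [Fintype ι] [Fintype κ₁] [Fintype κ₂] {μ : Measure Ω}
    [IsProbabilityMeasure μ]
    {X : Ω → ι → ℝ}
    {C : Matrix ι ι ℝ} (hC : C.PosDef) (hm : Measurable X) (h : IsZeroMeanGaussian μ X C)
    (l : κ₁ → ι → ℝ) (m : κ₂ → ι → ℝ) (horth : ∀ i j, l i ⬝ᵥ C *ᵥ m j = 0) :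
    IndepFun (fun ω i => lin X (l i) ω) (fun ω j => lin X (m j) ω) μ := by
  apply HasGaussianLaw.indepFun_of_covariance_eval
  · have := gaussLaw hm h
    let f : (ι → ℝ) →ₗ[ℝ] (κ₁ → ℝ) × (κ₂ → ℝ) :=
      (Matrix.mulVecLin (Matrix.of l)).prod (Matrix.mulVecLin (Matrix.of m))
    exact this.map f.toContinuousLinearMap
  · intro i j
    rw [lin_cov hC hm h, horth]

/-- the stacked vector with the components outside `U` set to zero -/
noncomputable def restr (n d : ℕ) (x : ℕ → Ω → Fin d → ℝ) (U : Set ℕ) :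
    Ω → Fin (n + 1) × Fin d → ℝ :=
  open Classical in
  fun ω p => if (p.1 : ℕ) ∈ U then x (p.1 : ℕ) ω p.2 else 0

theorem sigmaOf_eq {n d : ℕ} (x : ℕ → Ω → Fin d → ℝ) (U : Set ℕ) (hU : ∀ i ∈ U, i ≤ n) :
    sigmaOf x U = MeasurableSpace.comap (restr n d x U) inferInstance := by
  classical
  apply le_antisymm
  · refine iSup₂_le fun i hi => ?_
    have hin := hU i hi
    have : x i = (fun y : Fin (n + 1) × Fin d → ℝ => fun a => y (⟨i, by omega⟩, a)) ∘
        restr n d x U := by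
      ext ω a
      simp [restr, hi]
    rw [this, ← MeasurableSpace.comap_comp]
    apply MeasurableSpace.comap_mono
    have : Measurable (fun y : Fin (n + 1) × Fin d → ℝ => fun a => y (⟨i, by omega⟩, a)) := by
      fun_prop
    exact this.comap_le
  · rw [← measurable_iff_comap_le]
    refine (@measurable_pi_iff _ _ _ (sigmaOf x U) _ _).2 fun p => ?_
    by_cases hp : (p.1 : ℕ) ∈ U
    · simp only [restr, hp, if_true]
      have h1 : Measurable[sigmaOf x U] (x (p.1 : ℕ)) := by
        rw [measurable_iff_comap_le]
        exact le_iSup₂_of_le (f := fun i (_ : i ∈ U) => MeasurableSpace.comap (x i) inferInstance)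
          (p.1 : ℕ) hp le_rfl
      exact (measurable_pi_apply p.2).comp h1
    · simp only [restr, hp, if_false]
      exact measurable_const

theorem restr_measurable {n d : ℕ} (x : ℕ → Ω → Fin d → ℝ) (hm : ∀ k, k ≤ n → Measurable (x k))
    (U : Set ℕ) : Measurable (restr n d x U) := by
  classical
  refine measurable_pi_lambda _ fun p => ?_
  have := (measurable_pi_apply p.2).comp (hm p.1 (by have := p.1.isLt; omega))
  by_cases hp : (p.1 : ℕ) ∈ U
  · simpa only [restr, hp, if_true, Function.comp_def] using this
  · simp only [restr, hp, if_false]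
    exact measurable_const

theorem stack_measurable {n d : ℕ} (x : ℕ → Ω → Fin d → ℝ) (hm : ∀ k, k ≤ n → Measurable (x k)) :
    Measurable (stack n d x) := by
  refine measurable_pi_lambda _ fun p => ?_
  exact (measurable_pi_apply p.2).comp (hm p.1 (by have := p.1.isLt; omega))

theorem lin_restr {n d : ℕ} (x : ℕ → Ω → Fin d → ℝ) (U : Set ℕ) (w : Fin (n + 1) × Fin d → ℝ)
    (hw : ∀ p, (p.1 : ℕ) ∉ U → w p = 0) : lin (restr n d x U) w = lin (stack n d x) w := by
  ext ω
  refine Finset.sum_congr rfl fun p _ => ?_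
  by_cases hp : (p.1 : ℕ) ∈ U
  · simp [restr, stack, hp]
  · simp [hw p hp]

theorem lin_single {n d : ℕ} (x : ℕ → Ω → Fin d → ℝ) (p : Fin (n + 1) × Fin d) (ω : Ω) :
    lin (stack n d x) (Pi.single p 1) ω = x (p.1 : ℕ) ω p.2 := by
  classical
  simp [lin, stack, Pi.single_apply]

theorem restr_indep {n d : ℕ} {κ : Type*} [Fintype κ] {μ : Measure Ω} [IsProbabilityMeasure μ]
    {x : ℕ → Ω → Fin d → ℝ} {C : Matrix (Fin (n + 1) × Fin d) (Fin (n + 1) × Fin d) ℝ}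
    (hx : ZMNG n d μ x C) (U : Set ℕ) (m : κ → Fin (n + 1) × Fin d → ℝ)
    (h : ∀ j p, (p.1 : ℕ) ∈ U → (C *ᵥ (m j)) p = 0) :
    IndepFun (restr n d x U) (fun ω j => lin (stack n d x) (m j) ω) μ := by
  classical
  obtain ⟨hm, hg, hC⟩ := hx
  have := lin_indep hC (stack_measurable x hm) hg
    (fun p : Fin (n + 1) × Fin d => if (p.1 : ℕ) ∈ U then Pi.single p (1 : ℝ) else 0) m (by
      intro p j
      by_cases hp : (p.1 : ℕ) ∈ U
      · simp [hp, h j p hp]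
      · simp [hp])
  convert this using 1
  ext ω p
  by_cases hp : (p.1 : ℕ) ∈ U
  · simp [hp, restr, lin_single]
  · simp [hp, restr, lin]

theorem condExp_formula {n d : ℕ} {μ : Measure Ω} [IsProbabilityMeasure μ]
    {x : ℕ → Ω → Fin d → ℝ} {C : Matrix (Fin (n + 1) × Fin d) (Fin (n + 1) × Fin d) ℝ}
    (hx : ZMNG n d μ x C) (U : Set ℕ) (hU : ∀ i ∈ U, i ≤ n) (k : Fin (n + 1))
    (w : Fin d → Fin (n + 1) × Fin d → ℝ) (hw : ∀ b p, (p.1 : ℕ) ∉ U → w b p = 0)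
    (horth : ∀ b p, (p.1 : ℕ) ∈ U → (C *ᵥ (Pi.single (k, b) 1 - w b)) p = 0)
    (A : Set (Fin d → ℝ)) (hA : MeasurableSet A) :
    μ[A.indicator (fun _ => (1 : ℝ)) ∘ x k | sigmaOf x U]
      =ᵐ[μ] fun ω => ∫ y, A.indicator (fun _ => (1 : ℝ))
        (fun b => y b + lin (stack n d x) (w b) ω)
        ∂(μ.map (fun ω b => lin (stack n d x) (Pi.single (k, b) 1 - w b) ω)) := by
  classical
  have hm := hx.1
  rw [sigmaOf_eq x U hU]
  have hind := restr_indep hx U (fun b => Pi.single (k, b) 1 - w b) horth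
  have hYm : Measurable (fun ω b => lin (stack n d x) (Pi.single (k, b) 1 - w b) ω) :=
    measurable_pi_lambda _ fun b => lin_measurable (stack_measurable x hm) _
  let f : (Fin (n + 1) × Fin d → ℝ) × (Fin d → ℝ) → ℝ := fun z =>
    A.indicator (fun _ => (1 : ℝ)) (fun b => z.2 b + ∑ p, w b p * z.1 p)
  have hf : Measurable f := (measurable_const.indicator hA).comp (by fun_prop)
  have hXm := restr_measurable x hm U
  have key := condExp_indep_pair hXm hYm hind hf (by
    refine Integrable.of_bound (hf.comp (hXm.prodMk hYm)).aestronglyMeasurable 1 ?_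
    refine Filter.Eventually.of_forall fun ω => ?_
    simp only [f, Set.indicator]
    split_ifs <;> simp)
  have hl : ∀ b ω, ∑ p, w b p * restr n d x U ω p = lin (stack n d x) (w b) ω := fun b ω =>
    congrFun (lin_restr x U (w b) (hw b)) ω
  have e1 : (fun a => f (restr n d x U a,
      fun b => lin (stack n d x) (Pi.single (k, b) 1 - w b) a)) =
      A.indicator (fun _ => (1 : ℝ)) ∘ x k := by
    ext ω
    simp only [f, hl, Function.comp]
    congr 1
    ext b
    have := congrFun (lin_add (stack n d x) (Pi.single (k, b) 1 - w b) (w b)) ω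
    rw [sub_add_cancel, lin_single] at this
    exact this.symm
  rw [e1] at key
  refine key.trans (Filter.Eventually.of_forall fun ω => ?_)
  simp only [f, hl]

theorem condEq_of_orth {n d : ℕ} {μ : Measure Ω} [IsProbabilityMeasure μ]
    {x : ℕ → Ω → Fin d → ℝ} {C : Matrix (Fin (n + 1) × Fin d) (Fin (n + 1) × Fin d) ℝ}
    (hx : ZMNG n d μ x C) (S T : Set ℕ) (hS : ∀ i ∈ S, i ≤ n) (hTS : T ⊆ S) (k : Fin (n + 1))
    (w : Fin d → Fin (n + 1) × Fin d → ℝ) (hw : ∀ b p, (p.1 : ℕ) ∉ T → w b p = 0)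
    (horth : ∀ b p, (p.1 : ℕ) ∈ S → (C *ᵥ (Pi.single (k, b) 1 - w b)) p = 0) :
    CondEq μ x k S T := by
  intro A hA
  exact (condExp_formula hx S hS k w (fun b p hp => hw b p fun h => hp (hTS h)) horth A hA).trans
    (condExp_formula hx T (fun i hi => hS i (hTS hi)) k w hw
      (fun b p hp => horth b p (hTS hp)) A hA).symm

theorem orth_of_condEq {n d : ℕ} {μ : Measure Ω} [IsProbabilityMeasure μ]
    {x : ℕ → Ω → Fin d → ℝ} {C : Matrix (Fin (n + 1) × Fin d) (Fin (n + 1) × Fin d) ℝ}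
    (hx : ZMNG n d μ x C) (S T : Set ℕ) (hS : ∀ i ∈ S, i ≤ n) (hTS : T ⊆ S) (k : Fin (n + 1))
    (hcond : CondEq μ x k S T)
    (v : Fin (n + 1) × Fin d → ℝ) (hv : ∀ p, (p.1 : ℕ) ∉ S → v p = 0)
    (horth : ∀ p, (p.1 : ℕ) ∈ T → (C *ᵥ v) p = 0) (b : Fin d) :
    (C *ᵥ v) (k, b) = 0 := by
  classical
  have hm := hx.1
  have hXm := stack_measurable x hm
  have hTn : ∀ i ∈ T, i ≤ n := fun i hi => hS i (hTS hi)
  have hSle : sigmaOf x S ≤ inferInstanceAs (MeasurableSpace Ω) := by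
    rw [sigmaOf_eq x S hS]; exact (restr_measurable x hm S).comap_le
  have hTle : sigmaOf x T ≤ inferInstanceAs (MeasurableSpace Ω) := by
    rw [sigmaOf_eq x T hTn]; exact (restr_measurable x hm T).comap_le
  set r := lin (stack n d x) v with hr
  have hr2 : MemLp r 2 μ := lin_memLp hXm hx.2.1 v
  have hri : Integrable r μ := hr2.integrable (by norm_num)
  have hrS : StronglyMeasurable[sigmaOf x S] r := by
    rw [hr, ← lin_restr x S v hv, sigmaOf_eq x S hS]
    refine Measurable.stronglyMeasurable ?_
    exact (lin_measurable (Ω := Fin (n + 1) × Fin d → ℝ) (X := id) measurable_id v).comp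
      (comap_measurable _)
  have hrT : μ[r | sigmaOf x T] =ᵐ[μ] fun _ => 0 := by
    have hind := restr_indep hx T (fun _ : Unit => v) (fun _ p hp => horth p hp)
    have hind' : IndepFun r (restr n d x T) μ :=
      (hind.comp (measurable_id) (measurable_pi_apply ())).symm
    rw [sigmaOf_eq x T hTn]
    have := condExp_indep_eq (lin_measurable hXm v).comap_le (restr_measurable x hm T).comap_le
      (f := r) (comap_measurable r).stronglyMeasurable hind'
    refine this.trans ?_
    rw [hr, lin_mean hXm hx.2.1]
  have hxk := hm k (by have := k.isLt; omega)
  have hA : ∀ A : Set (Fin d → ℝ), MeasurableSet A → ∫ ω in x k ⁻¹' A, r ω ∂μ = 0 := by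
    intro A hA
    set g : Ω → ℝ := A.indicator (fun _ => (1 : ℝ)) ∘ x k with hg
    have hgm : Measurable g := (measurable_const.indicator hA).comp hxk
    have hg2 : MemLp g 2 μ := by
      refine MemLp.of_bound hgm.aestronglyMeasurable 1 (Filter.Eventually.of_forall fun ω => ?_)
      simp only [hg, Function.comp, Set.indicator]
      split_ifs <;> simp
    have hgi : Integrable g μ := hg2.integrable (by norm_num)
    have hgT2 : MemLp (μ[g | sigmaOf x T]) 2 μ := hg2.condExp (by norm_num)
    calc ∫ ω in x k ⁻¹' A, r ω ∂μ = ∫ ω, (g * r) ω ∂μ := by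
          rw [← integral_indicator (hxk hA)]
          congr 1
          ext ω
          by_cases h : x k ω ∈ A <;> simp [hg, Set.indicator, h]
      _ = ∫ ω, (μ[g * r | sigmaOf x S]) ω ∂μ := (integral_condExp hSle).symm
      _ = ∫ ω, (μ[g | sigmaOf x S] * r) ω ∂μ := integral_congr_ae
          (condExp_mul_of_stronglyMeasurable_right hrS (hg2.integrable_mul hr2) hgi)
      _ = ∫ ω, (μ[g | sigmaOf x T] * r) ω ∂μ := by
          refine integral_congr_ae ?_
          filter_upwards [hcond A hA] with ω hω
          simp only [Pi.mul_apply]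
          rw [hω]
      _ = ∫ ω, (μ[μ[g | sigmaOf x T] * r | sigmaOf x T]) ω ∂μ := (integral_condExp hTle).symm
      _ = ∫ ω, (μ[g | sigmaOf x T] * μ[r | sigmaOf x T]) ω ∂μ := integral_congr_ae
          (condExp_mul_of_stronglyMeasurable_left stronglyMeasurable_condExp
            (hgT2.integrable_mul hr2) hri)
      _ = 0 := by
          rw [integral_eq_zero_of_ae]
          filter_upwards [hrT] with ω hω
          simp [hω]
  have hrk : (fun _ => (0 : ℝ)) =ᵐ[μ] μ[r | MeasurableSpace.comap (x k) inferInstance] := by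
    refine ae_eq_condExp_of_forall_setIntegral_eq hxk.comap_le hri ?_ ?_ ?_
    · intro s _ _
      exact integrableOn_zero
    · rintro s ⟨A, hAm, rfl⟩ _
      rw [hA A hAm]; simp
    · exact aestronglyMeasurable_const
  have hfin := lin_integral_mul hx.2.2 hXm hx.2.1 (Pi.single (k, b) 1) v
  rw [single_one_dotProduct] at hfin
  rw [← hfin]
  have hs2 := lin_memLp hXm hx.2.1 (Pi.single (k, b) 1)
  have hsm : StronglyMeasurable[MeasurableSpace.comap (x k) inferInstance]
      (lin (stack n d x) (Pi.single (k, b) 1)) := by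
    have : lin (stack n d x) (Pi.single (k, b) 1) = (fun y : Fin d → ℝ => y b) ∘ x k := by
      ext ω
      rw [lin_single]; rfl
    rw [this]
    exact ((measurable_pi_apply b).comp (comap_measurable (x k))).stronglyMeasurable
  rw [← integral_condExp hxk.comap_le, integral_eq_zero_of_ae]
  filter_upwards [condExp_mul_of_stronglyMeasurable_left hsm (hs2.integrable_mul hr2) hri, hrk]
    with ω h1 h2
  rw [h1, Pi.mul_apply, ← h2]
  simp

theorem zmng_restrict {N d : ℕ} {μ : Measure Ω} {x : ℕ → Ω → Fin d → ℝ}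
    {C : Matrix (Fin (N + 1) × Fin d) (Fin (N + 1) × Fin d) ℝ}
    (hx : ZMNG N d μ x C) (n : ℕ) (hn : n + 1 ≤ N + 1)
    (f : Fin (n + 1) × Fin d → Fin (N + 1) × Fin d)
    (hf : ∀ p, f p = (Fin.castLE hn p.1, p.2)) :
    ZMNG n d μ x (C.submatrix f f) := by
  classical
  have hfi : Function.Injective f := by
    rintro ⟨i, a⟩ ⟨j, b⟩ h
    simpa [hf] using h
  refine ⟨fun k hk => hx.1 k (by omega), fun l => ?_, posdef_submatrix hx.2.2 f hfi⟩
  let w : Fin (N + 1) × Fin d → ℝ := fun i => ∑ k, if f k = i then l k else 0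
  have hw : ∀ g : Fin (N + 1) × Fin d → ℝ, ∑ i, w i * g i = ∑ k, l k * g (f k) := by
    intro g
    simp only [w, Finset.sum_mul]
    rw [Finset.sum_comm]
    refine Finset.sum_congr rfl fun k _ => ?_
    rw [Finset.sum_eq_single (f k)] <;> simp +contextual [eq_comm]
  have h1 := hx.2.1 w
  have e1 : (fun ω => ∑ i, w i * stack N d x ω i) = fun ω => ∑ i, l i * stack n d x ω i := by
    ext ω
    rw [hw]
    refine Finset.sum_congr rfl fun k _ => ?_
    simp [hf, stack]
  have e2 : w ⬝ᵥ C *ᵥ w = l ⬝ᵥ (C.submatrix f f) *ᵥ l := by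
    simp only [dotProduct, mulVec, submatrix_apply]
    rw [hw]
    refine Finset.sum_congr rfl fun k _ => ?_
    congr 1
    have := hw (fun j => C (f k) j)
    simpa [mul_comm] using this
  rwa [e1, e2] at h1

theorem isCM_iff {n d : ℕ} {μ : Measure Ω} [IsProbabilityMeasure μ]
    {x : ℕ → Ω → Fin d → ℝ} {C : Matrix (Fin (n + 1) × Fin d) (Fin (n + 1) × Fin d) ℝ}
    (hx : ZMNG n d μ x C) (c : ℕ) (hc : c ≤ n) :
    IsCM μ x 0 n c ↔ ∀ i k : Fin (n + 1), (i : ℕ) + 2 ≤ k → (i : ℕ) ≠ c → (k : ℕ) ≠ c →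
      BlockZero C⁻¹ i k := by
  classical
  have hC := hx.2.2
  constructor
  · intro h i k hik hic hkc a b
    let j := (i : ℕ) + 1
    let M : Set (Fin (n + 1) × Fin d) := {p | (p.1 : ℕ) = j ∨ (p.1 : ℕ) = c}
    have := alg_backward hC {p | (p.1 : ℕ) < j ∧ (p.1 : ℕ) ≠ c} M
      {p | j < (p.1 : ℕ) ∧ (p.1 : ℕ) ≠ c}
      (by intro p; simp only [M, Set.mem_setOf_eq]; omega)
      (by intro p; simp only [Set.mem_setOf_eq]; omega)
      (by intro p; simp only [M, Set.mem_setOf_eq]; omega)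
      (by intro p; simp only [M, Set.mem_setOf_eq]; omega)
      (by
        intro l hl
        obtain ⟨w, hw, hz⟩ := solve hC M (Pi.single l 1)
        refine ⟨w, hw, ?_⟩
        rintro q (hq | hq)
        · exact hz q hq
        · have hkn := q.1.isLt
          refine orth_of_condEq hx (Set.Icc 0 j ∪ {c}) ({j} ∪ {c}) ?_ ?_ q.1
            (h j q.1 (Nat.zero_le _) hq.1 (by omega)) _ ?_ ?_ q.2
          · rintro m (hm | hm)
            · have := hm.2
              have := hq.1
              omega
            · rw [hm]; exact hc
          · rintro m (hm | hm)
            · exact Or.inl ⟨Nat.zero_le _, le_of_eq hm⟩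
            · exact Or.inr hm
          · intro p hp
            simp only [Set.mem_union, Set.mem_Icc, Set.mem_singleton_iff] at hp
            have h1 : p ≠ l := by
              rintro rfl
              have := hl.1
              omega
            have h2 : p ∉ M := by
              simp only [M, Set.mem_setOf_eq]
              omega
            simp [h1, hw p h2]
          · intro p hp
            exact hz p hp)
      (i, a) ⟨by simp [j], hic⟩ (k, b) ⟨by simp only [j]; omega, hkc⟩
    have hs := hC.inv.1.apply (k, b) (i, a)
    rw [this] at hs
    simpa using hs
  · intro h j k _ hjk hk
    obtain ⟨k, rfl⟩ : ∃ k' : Fin (n + 1), (k' : ℕ) = k := ⟨⟨k, by omega⟩, rfl⟩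
    have hS : ∀ i ∈ Set.Icc 0 j ∪ {c}, i ≤ n := by
      rintro m (hm | hm)
      · have := hm.2
        omega
      · rw [hm]; exact hc
    have hTS : ({j} ∪ {c} : Set ℕ) ⊆ Set.Icc 0 j ∪ {c} := by
      rintro m (hm | hm)
      · exact Or.inl ⟨Nat.zero_le _, le_of_eq hm⟩
      · exact Or.inr hm
    by_cases hkc : (k : ℕ) = c
    · refine condEq_of_orth hx _ _ hS hTS k (fun b => Pi.single (k, b) 1) ?_ ?_
      · intro b p hp
        have : p ≠ (k, b) := by
          rintro rfl
          exact hp (Or.inr hkc)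
        simp [this]
      · intro b p _
        simp
    · let M : Set (Fin (n + 1) × Fin d) := {p | (p.1 : ℕ) = j ∨ (p.1 : ℕ) = c}
      have H := fun b : Fin d => alg_forward hC {p | j < (p.1 : ℕ) ∧ (p.1 : ℕ) ≠ c} M
        {p | (p.1 : ℕ) < j ∧ (p.1 : ℕ) ≠ c}
        (by intro p; simp only [M, Set.mem_setOf_eq]; omega)
        (by intro p; simp only [M, Set.mem_setOf_eq]; omega)
        (by
          rintro ⟨l, a⟩ ⟨hl1, hl2⟩ ⟨r, a'⟩ ⟨hr1, hr2⟩
          simp only at hl1 hl2 hr1 hr2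
          exact h r l (by omega) hr2 hl2 a' a)
        (Pi.single (k, b) 1) (by
          intro p hp
          have : p ≠ (k, b) := by
            rintro rfl
            have := hp.1
            simp only at this
            omega
          simp [this])
      choose w hw hz using H
      refine condEq_of_orth hx _ _ hS hTS k w (fun b p hp => hw b p hp) ?_
      intro b p hp
      apply hz b p
      simp only [Set.mem_union, Set.mem_Icc, Set.mem_singleton_iff] at hp
      simp only [M, Set.mem_setOf_eq]
      omega

/-- For `k₂ ∈ [1,N-1]` and `c ∈ {0,k₂}`: `[x_k]` is `[0,k₂]`-CM_c
iff the Schur complement `Δ_{A22} = A11 - A12 A22⁻¹ A12'` of `A = C⁻¹` has the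
CM_c form (as a matrix of `(k₂+1) × (k₂+1)` blocks of size `d × d`). -/
theorem stmt4 {N d : ℕ} (hN : 3 ≤ N) (hd : 1 ≤ d)
    (μ : Measure Ω) [IsProbabilityMeasure μ] (x : ℕ → Ω → Fin d → ℝ)
    (C : Matrix (Fin (N + 1) × Fin d) (Fin (N + 1) × Fin d) ℝ)
    (hx : ZMNG N d μ x C) (k₂ c : ℕ) (hk₂1 : 1 ≤ k₂) (hk₂2 : k₂ ≤ N - 1)
    (hc : c = 0 ∨ c = k₂) :
    let A := C⁻¹
    let r1 : Fin (k₂ + 1) → Fin (N + 1) := Fin.castLE (by omega)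
    let r2 : Fin (N - k₂) → Fin (N + 1) :=
      fun j => Fin.cast (by omega) (Fin.natAdd (k₂ + 1) j)
    let A11 : Matrix (Fin (k₂ + 1) × Fin d) (Fin (k₂ + 1) × Fin d) ℝ :=
      fun p q => A (r1 p.1, p.2) (r1 q.1, q.2)
    let A22 : Matrix (Fin (N - k₂) × Fin d) (Fin (N - k₂) × Fin d) ℝ :=
      fun p q => A (r2 p.1, p.2) (r2 q.1, q.2)
    let A12 : Matrix (Fin (k₂ + 1) × Fin d) (Fin (N - k₂) × Fin d) ℝ :=
      fun p q => A (r1 p.1, p.2) (r2 q.1, q.2)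
    let Δ := A11 - A12 * A22⁻¹ * A12ᵀ
    (IsCM μ x 0 k₂ c ↔ (if c = 0 then HasCMFForm Δ else HasCMLForm Δ)) := by
  intro A r1 r2 A11 A22 A12 Δ
  let f : Fin (k₂ + 1) × Fin d → Fin (N + 1) × Fin d := fun p => (r1 p.1, p.2)
  let g : Fin (N - k₂) × Fin d → Fin (N + 1) × Fin d := fun p => (r2 p.1, p.2)
  have hbij : Function.Bijective (Sum.elim f g) := by
    constructor
    · rintro (⟨i, a⟩ | ⟨i, a⟩) (⟨j, b⟩ | ⟨j, b⟩) h <;>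
        simp [f, g, r1, r2, Fin.ext_iff] at h ⊢ <;> omega
    · rintro ⟨i, a⟩
      by_cases hi : (i : ℕ) < k₂ + 1
      · exact ⟨Sum.inl (⟨i, hi⟩, a), by simp [f, r1]⟩
      · refine ⟨Sum.inr (⟨i - (k₂ + 1), by have := i.isLt; omega⟩, a), ?_⟩
        simp [g, r2, Fin.ext_iff]
        omega
  have hΔ : Δ = (C.submatrix f f)⁻¹ := schur_inv hx.2.2 f g hbij
  have hx' := zmng_restrict hx k₂ (by omega) f (fun p => rfl)
  rw [isCM_iff hx' c (by omega), ← hΔ]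
  have hsymm : ∀ i k, BlockZero Δ i k → BlockZero Δ k i := by
    intro i k h a b
    have := hx'.2.2.inv.1.apply (k, a) (i, b)
    rw [← hΔ, h b a] at this
    simpa using this.symm
  split_ifs with hc0
  · subst hc0
    constructor
    · rintro h i j (hij | hij) hi hj
      · exact h i j hij hi hj
      · exact hsymm _ _ (h j i hij hj hi)
    · intro h i k hik hi hk
      exact h i k (Or.inl hik) hi hk
  · have hck : c = k₂ := hc.resolve_left hc0
    subst hck
    constructor
    · rintro h i j (hij | hij) hi hj
      · exact h i j hij hi hj
      · exact hsymm _ _ (h j i hij hj hi)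
    · intro h i k hik hi hk
      exact h i k (Or.inl hik) hi hk

end CMSeqPaper
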